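/- Let λ₁ ≥ λ₂ ≥ λ₃ ≥ λ₄ be integers summing to zero with λ₂ > 0 > λ₃, λ₁+λ₄ < 0, and λ₂+2λ₃ ≥ 0. Then Σ_{λ₂ ≥ μ₂ > λ₂+λ₃} Σ_{-λ₄-μ₂ ≥ μ₁ ≥ λ₂} (μ₁-μ₂+1) + Σ_{λ₂+λ₃ ≥ μ₂ ≥ 0} Σ_{λ₁ ≥ μ₁ ≥ λ₂} (μ₁-μ₂+1) + Σ_{0 > μ₂ ≥ λ₃} Σ_{λ₁ ≥ μ₁ ≥ λ₂} (μ₁+2μ₂+1) = (1/2)(-λ₁+λ₂-1)(-λ₁λ₂+λ₁λ₃+λ₂λ₃+3λ₃²-λ₁-2λ₂-λ₃-2), where λ₄ = -(λ₁+λ₂+λ₃). -/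

import Mathlib

theorem sum_Ico_int_quadratic (α β γ : ℚ) {a b : ℤ} (h : a ≤ b) :
    ∑ x ∈ Finset.Ico a b, (α * (x : ℚ) ^ 2 + β * x + γ) =
      (α * (b * (b - 1) * (2 * b - 1) / 6) + β * (b * (b - 1) / 2) + γ * b) -
        (α * (a * (a - 1) * (2 * a - 1) / 6) + β * (a * (a - 1) / 2) + γ * a) := by
  induction b, h using Int.leInduction with
  | base => simp
  | succ n hn ih =>
    have hIco : Finset.Ico a (n + 1) = insert n (Finset.Ico a n) := by
      ext x
      simp only [Finset.mem_Ico, Finset.mem_insert]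
      omega
    rw [hIco, Finset.sum_insert (by simp), ih]
    push_cast
    ring

theorem sum_Icc_int_add (k : ℚ) {a b : ℤ} (h : a ≤ b + 1) :
    ∑ x ∈ Finset.Icc a b, ((x : ℚ) + k) = (b + 1 - a) * (a + b + 2 * k) / 2 := by
  have hIcc : Finset.Icc a b = Finset.Ico a (b + 1) := by
    ext x
    simp only [Finset.mem_Icc, Finset.mem_Ico]
    omega
  have hq := sum_Ico_int_quadratic 0 1 k h
  simp only [zero_mul, zero_add, one_mul] at hq
  rw [hIcc, hq]
  push_cast
  ring

theorem stmt_18 (l1 l2 l3 l4 : ℤ) (h12 : l2 ≤ l1) (h23 : l3 ≤ l2) (h34 : l4 ≤ l3)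
    (hsum : l1 + l2 + l3 + l4 = 0) (h2 : 0 < l2) (h3 : l3 < 0)
    (h14 : l1 + l4 < 0) (h233 : 0 ≤ l2 + 2*l3) :
    (((∑ μ2 ∈ Finset.Ioc (l2 + l3) l2, ∑ μ1 ∈ Finset.Icc l2 (-l4 - μ2),
        (μ1 - μ2 + 1)) +
      (∑ μ2 ∈ Finset.Icc 0 (l2 + l3), ∑ μ1 ∈ Finset.Icc l2 l1,
        (μ1 - μ2 + 1)) +
      (∑ μ2 ∈ Finset.Ico l3 0, ∑ μ1 ∈ Finset.Icc l2 l1,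
        (μ1 + 2*μ2 + 1)) : ℤ) : ℚ)
    = (1/2 : ℚ) * (-l1 + l2 - 1) *
        (-l1*l2 + l1*l3 + l2*l3 + 3*l3^2 - l1 - 2*l2 - l3 - 2) := by
  obtain rfl : l4 = -(l1 + l2 + l3) := by omega
  have upper_sum : (∑ μ2 ∈ Finset.Ioc (l2 + l3) l2,
      ∑ μ1 ∈ Finset.Icc l2 (-(-(l1 + l2 + l3)) - μ2), ((μ1 : ℚ) - μ2 + 1)) =
      ∑ μ2 ∈ Finset.Ico (l2 + l3 + 1) (min l2 (l1 + l3) + 1),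
        ((3 / 2 : ℚ) * (μ2 : ℚ) ^ 2 + (-(2 * l1 + l2 + 2 * l3) - 5 / 2 : ℚ) * μ2 +
          ((l1 + l3 + 1) * (l1 + 2 * l2 + l3 + 2) / 2 : ℚ)) := by
    symm
    refine Finset.sum_subset_zero_on_sdiff ?_ ?_ ?_
    · intro x
      simp only [Finset.mem_Ico, Finset.mem_Ioc]
      omega
    · intro x hx
      simp only [Finset.mem_sdiff, Finset.mem_Ico, Finset.mem_Ioc] at hx
      rw [Finset.Icc_eq_empty (by omega), Finset.sum_empty]
    · intro x hx
      simp only [Finset.mem_Ico] at hx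
      have hinner := sum_Icc_int_add (1 - x) (a := l2) (b := -(-(l1 + l2 + l3)) - x) (by omega)
      simp only [sub_add_eq_add_sub, add_sub_assoc] at hinner ⊢
      rw [hinner]
      push_cast
      ring
  have middle_sum : (∑ μ2 ∈ Finset.Icc 0 (l2 + l3),
      ∑ μ1 ∈ Finset.Icc l2 l1, ((μ1 : ℚ) - μ2 + 1)) =
      ∑ μ2 ∈ Finset.Ico 0 (l2 + l3 + 1),
        (0 * (μ2 : ℚ) ^ 2 + (-(l1 + 1 - l2) : ℚ) * μ2 +
          ((l1 + 1 - l2) * (l1 + l2 + 2) / 2 : ℚ)) := by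
    refine Finset.sum_congr (by ext; simp only [Finset.mem_Ico, Finset.mem_Icc]; omega) ?_
    intro x _
    have hinner := sum_Icc_int_add (1 - x) (a := l2) (b := l1) (by omega)
    simp only [sub_add_eq_add_sub, add_sub_assoc] at hinner ⊢
    rw [hinner]
    ring
  have lower_sum : (∑ μ2 ∈ Finset.Ico l3 0,
      ∑ μ1 ∈ Finset.Icc l2 l1, ((μ1 : ℚ) + 2 * μ2 + 1)) =
      ∑ μ2 ∈ Finset.Ico l3 0,
        (0 * (μ2 : ℚ) ^ 2 + (2 * (l1 + 1 - l2) : ℚ) * μ2 +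
          ((l1 + 1 - l2) * (l1 + l2 + 2) / 2 : ℚ)) := by
    refine Finset.sum_congr rfl ?_
    intro x _
    have hinner := sum_Icc_int_add (2 * x + 1) (a := l2) (b := l1) (by omega)
    simp only [← add_assoc] at hinner
    rw [hinner]
    ring
  push_cast
  rw [upper_sum, middle_sum, lower_sum, sum_Ico_int_quadratic _ _ _ (by omega),
    sum_Ico_int_quadratic _ _ _ (by omega), sum_Ico_int_quadratic _ _ _ (by omega)]
  rcases le_total l2 (l1 + l3) with h | h
  · rw [min_eq_left h]
    push_cast
    ring
  · rw [min_eq_right h]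
    push_cast
    ring
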